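/- Under the stated hypotheses and assuming additionally γ·L ≤ 1, it holds that 2·⟨x − x̂, x − x̄⟩ ≥ ‖x − x̄‖². -/

import Mathlib

open scoped RealInnerProductSpace

/-- Two points satisfying each other's projection variational inequality are no farther apart than
the points being projected. -/
theorem norm_sub_le_of_inner_sub_nonpos {E : Type*} [NormedAddCommGroup E] [InnerProductSpace ℝ E]
    {a b p q : E} (hp : ⟪a - p, q - p⟫ ≤ 0) (hq : ⟪b - q, p - q⟫ ≤ 0) :
    ‖p - q‖ ≤ ‖a - b‖ := by
  have key : ‖p - q‖ ^ 2 ≤ ⟪a - b, p - q⟫ := by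
    rw [← real_inner_self_eq_norm_sq]
    simp only [inner_sub_left, inner_sub_right] at hp hq ⊢
    linarith
  have hcs := real_inner_le_norm (a - b) (p - q)
  by_contra! h
  nlinarith [norm_nonneg (a - b)]

/-- Under the hypotheses of Statement 10 and assuming in
addition `γ·L ≤ 1`, it holds that `2⟪x − x̂, x − x̄⟫ ≥ ‖x − x̄‖²`. -/
theorem projection_prox_inner_bound {n : ℕ}
    (C : Set (EuclideanSpace ℝ (Fin n)))
    (hCne : C.Nonempty) (hCcl : IsClosed C) (hCconv : Convex ℝ C)
    (ℓ : EuclideanSpace ℝ (Fin n) → ℝ)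
    (gl : EuclideanSpace ℝ (Fin n) → EuclideanSpace ℝ (Fin n))
    (hgrad : ∀ u, HasGradientAt ℓ (gl u) u)
    (L : ℝ) (hL : 0 < L)
    (hLip : ∀ u v, ‖gl u - gl v‖ ≤ L * ‖u - v‖)
    (γ : ℝ) (hγ : 0 < γ) (hγL : γ * L ≤ 1)
    (x xbar xhat : EuclideanSpace ℝ (Fin n))
    (hxbarC : xbar ∈ C) (hxhatC : xhat ∈ C)
    (hbar : ∀ z ∈ C, ⟪x - γ • gl x - xbar, z - xbar⟫ ≤ 0)
    (hhat : ∀ z ∈ C, ⟪x - γ • gl xhat - xhat, z - xhat⟫ ≤ 0) :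
    2 * ⟪x - xhat, x - xbar⟫ ≥ ‖x - xbar‖ ^ 2 := by
  have hproj : ‖xbar - xhat‖ ≤ ‖x - xhat‖ :=
    calc ‖xbar - xhat‖ ≤ ‖(x - γ • gl x) - (x - γ • gl xhat)‖ :=
          norm_sub_le_of_inner_sub_nonpos (hbar xhat hxhatC) (hhat xbar hxbarC)
      _ = γ * ‖gl x - gl xhat‖ := by
          rw [sub_sub_sub_cancel_left, ← smul_sub, norm_smul, Real.norm_of_nonneg hγ.le,
            norm_sub_rev]
      _ ≤ γ * (L * ‖x - xhat‖) := by gcongr; exact hLip x xhat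
      _ = γ * L * ‖x - xhat‖ := by ring
      _ ≤ ‖x - xhat‖ := mul_le_of_le_one_left (norm_nonneg _) hγL
  have hcos := norm_sub_sq_real (x - xhat) (x - xbar)
  rw [sub_sub_sub_cancel_left] at hcos
  have hsq : ‖xbar - xhat‖ ^ 2 ≤ ‖x - xhat‖ ^ 2 := by gcongr
  linarith
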